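/- For every α ∈ [0,1] and every f ∈ F, the function Φ_α(f) again belongs to F; that is, the operator Φ_α maps the class F into itself. -/

import Mathlib

/-- The `L¹` distance between two vectors indexed by a finite set. -/
noncomputable def dist1 {S : Type*} [Fintype S] (p p' : S → ℝ) : ℝ :=
  ∑ k, |p k - p' k|

/-- Row-vector times matrix multiplication, `(p A) k' = ∑ k, p k * A k k'`. -/
noncomputable def vecMulF {K : Type*} [Fintype K] (p : K → ℝ) (A : K → K → ℝ) : K → ℝ :=
  fun k' => ∑ k, p k * A k k'

/-- A recurrence structure on a finite set `K`: a partition of `K` into `R` nonempty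
classes (given by the class map `cls`, surjectivity expressing nonemptiness of classes),
together with, for each class `r`, a probability vector `pstar r ∈ Δ(K)` supported
in the class `r`. -/
structure RecStruct (K : Type*) [Fintype K] (R : ℕ) where
  cls : K → Fin R
  cls_surj : Function.Surjective cls
  pstar : Fin R → K → ℝ
  pstar_mem : ∀ r, pstar r ∈ stdSimplex ℝ K
  pstar_supp : ∀ r k, pstar r k ≠ 0 → cls k = r

namespace RecStruct

variable {K : Type*} [Fintype K] {R : ℕ}

/-- `lam rs p r` is the total mass given by `p` to the recurrence class `r`. -/
noncomputable def lam (rs : RecStruct K R) (p : K → ℝ) : Fin R → ℝ :=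
  fun r => ∑ k, if rs.cls k = r then p k else 0

/-- The conditional law of `p` given the recurrence class `r` (equal to `pstar r` when the
class has zero mass under `p`). -/
noncomputable def cond (rs : RecStruct K R) (p : K → ℝ) (r : Fin R) : K → ℝ :=
  if 0 < rs.lam p r then (fun k => if rs.cls k = r then p k / rs.lam p r else 0)
  else rs.pstar r

/-- The quantity `S(p,p') = ‖λ(p) - λ(p')‖₁ + ∑_{r : λ(p)^r λ(p')^r > 0} λ(p')^r ‖p_{|r} - p'_{|r}‖₁`. -/
noncomputable def Sdist (rs : RecStruct K R) (p p' : K → ℝ) : ℝ :=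
  dist1 (rs.lam p) (rs.lam p') +
    ∑ r, if 0 < rs.lam p r * rs.lam p' r
      then rs.lam p' r * dist1 (rs.cond p r) (rs.cond p' r) else 0

/-- The projection matrix `B`, whose row `k` is `pstar r` where `r` is the class of `k`. -/
noncomputable def Bmat (rs : RecStruct K R) : K → K → ℝ :=
  fun k k' => rs.pstar (rs.cls k) k'

/-- `P*`, the convex hull of the invariant measures of the classes. -/
noncomputable def Pset (rs : RecStruct K R) : Set (K → ℝ) :=
  convexHull ℝ (Set.range rs.pstar)

/-- `B^{-1}(p*) = {p ∈ Δ(K) : pB = p*}`. -/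
def Binv (rs : RecStruct K R) (pst : K → ℝ) : Set (K → ℝ) :=
  {p | p ∈ stdSimplex ℝ K ∧ vecMulF p rs.Bmat = pst}

/-- A stochastic matrix on `K` compatible with the recurrence structure: it is block
diagonal with respect to the partition and each `pstar r` is invariant. -/
structure IsCompatible (rs : RecStruct K R) (M : K → K → ℝ) : Prop where
  nonneg : ∀ k k', 0 ≤ M k k'
  rowSum : ∀ k, ∑ k', M k k' = 1
  block : ∀ k k', rs.cls k ≠ rs.cls k' → M k k' = 0
  invariant : ∀ r, vecMulF (rs.pstar r) M = rs.pstar r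

end RecStruct

/-- `xOfp p x i = x(p)(i) = ∑ k, p^k x^k(i)`, the total probability of action `i`. -/
noncomputable def xOfp {K I : Type*} [Fintype K] (p : K → ℝ) (x : K → I → ℝ) (i : I) : ℝ :=
  ∑ k, p k * x k i

/-- `pvec p x i = p⃗(x,i)`, the conditional law on `K` after action `i` is observed
(junk value when `x(p)(i) = 0`). -/
noncomputable def pvec {K I : Type*} [Fintype K] (p : K → ℝ) (x : K → I → ℝ) (i : I) : K → ℝ :=
  fun k => p k * x k i / xOfp p x i

/-- The set `NR(p)` of nonrevealing one-stage strategies at `p`: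
profiles `x ∈ Δ(I)^K` such that `(p^k x^k(i))_k · B = x(p)(i) · (pB)` for every action `i`. -/
def NR {K I : Type*} [Fintype K] [Fintype I] {R : ℕ}
    (rs : RecStruct K R) (p : K → ℝ) : Set (K → I → ℝ) :=
  {x | (∀ k, x k ∈ stdSimplex ℝ I) ∧
    ∀ i, vecMulF (fun k => p k * x k i) rs.Bmat = xOfp p x i • vecMulF p rs.Bmat}

/-- The expected one-stage payoff `G(p,q,x,y)`. -/
noncomputable def Gpay {K L I J : Type*} [Fintype K] [Fintype L] [Fintype I] [Fintype J]
    (g : K → L → I → J → ℝ) (p : K → ℝ) (q : L → ℝ) (x : K → I → ℝ) (y : L → J → ℝ) : ℝ :=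
  ∑ k, ∑ l, ∑ i, ∑ j, p k * q l * x k i * y l j * g k l i j

/-- The payoff of the one-shot game defining the operator `Φ_α`:
`α G(p,q,x,y) + (1-α) ∑_{i,j} x(p)(i) y(q)(j) f(p⃗(x,i)M, q⃗(y,j)N)`
(summands with zero coefficient vanish). -/
noncomputable def payoff {K L I J : Type*} [Fintype K] [Fintype L] [Fintype I] [Fintype J]
    (M : K → K → ℝ) (N : L → L → ℝ) (g : K → L → I → J → ℝ) (α : ℝ)
    (f : (K → ℝ) → (L → ℝ) → ℝ) (p : K → ℝ) (q : L → ℝ)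
    (x : K → I → ℝ) (y : L → J → ℝ) : ℝ :=
  α * Gpay g p q x y + (1 - α) * ∑ i, ∑ j,
    xOfp p x i * xOfp q y j * f (vecMulF (pvec p x i) M) (vecMulF (pvec q y j) N)

/-- The operator `Φ_α(f)(p,q) = sup_{x ∈ NR(p)} inf_{y ∈ NR(q)} [payoff]`. -/
noncomputable def Phi {K L I J : Type*} [Fintype K] [Fintype L] [Fintype I] [Fintype J]
    {RK RL : ℕ} (rsK : RecStruct K RK) (rsL : RecStruct L RL)
    (M : K → K → ℝ) (N : L → L → ℝ) (g : K → L → I → J → ℝ) (α : ℝ)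
    (f : (K → ℝ) → (L → ℝ) → ℝ) (p : K → ℝ) (q : L → ℝ) : ℝ :=
  sSup {v : ℝ | ∃ x ∈ (NR rsK p : Set (K → I → ℝ)),
    v = sInf {u : ℝ | ∃ y ∈ (NR rsL q : Set (L → J → ℝ)),
      u = payoff M N g α f p q x y}}

/-- The class `F` of functions `f : Δ(K)×Δ(L) → [-1,1]` such that
(i) `f(p,q) - f(p',q) ≤ S_K(p,p')`, (ii) `f(p,q) - f(p,q') ≤ S_L(q',q)`, and
(iii) for all `p* ∈ P*`, `q* ∈ Q*`, `f` is concave in `p` on `B^{-1}(p*)` and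
convex in `q` on `C^{-1}(q*)`. -/
structure MemF {K L : Type*} [Fintype K] [Fintype L] {RK RL : ℕ}
    (rsK : RecStruct K RK) (rsL : RecStruct L RL)
    (f : (K → ℝ) → (L → ℝ) → ℝ) : Prop where
  mem_Icc : ∀ p ∈ stdSimplex ℝ K, ∀ q ∈ stdSimplex ℝ L, f p q ∈ Set.Icc (-1 : ℝ) 1
  lipK : ∀ p ∈ stdSimplex ℝ K, ∀ p' ∈ stdSimplex ℝ K, ∀ q ∈ stdSimplex ℝ L,
    f p q - f p' q ≤ rsK.Sdist p p'
  lipL : ∀ p ∈ stdSimplex ℝ K, ∀ q ∈ stdSimplex ℝ L, ∀ q' ∈ stdSimplex ℝ L,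
    f p q - f p q' ≤ rsL.Sdist q' q
  concaveI : ∀ pst ∈ rsK.Pset, ∀ q ∈ stdSimplex ℝ L,
    ConcaveOn ℝ (rsK.Binv pst) (fun p => f p q)
  convexII : ∀ qst ∈ rsL.Pset, ∀ p ∈ stdSimplex ℝ K,
    ConvexOn ℝ (rsL.Binv qst) (fun q => f p q)

open Finset

namespace RecStruct

variable {K : Type*} [Fintype K] {R : ℕ} (rs : RecStruct K R)

lemma lam_nonneg {p : K → ℝ} (hp : ∀ k, 0 ≤ p k) (r : Fin R) : 0 ≤ rs.lam p r :=
  Finset.sum_nonneg fun k _ => by split_ifs <;> simp [hp]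

lemma lam_eq_sum_filter (p : K → ℝ) (r : Fin R) :
    rs.lam p r = ∑ k ∈ univ.filter (fun k => rs.cls k = r), p k := by
  simp [lam, Finset.sum_filter]

lemma lam_congr {p p' : K → ℝ} {r : Fin R} (h : ∀ k, rs.cls k = r → p k = p' k) :
    rs.lam p r = rs.lam p' r :=
  Finset.sum_congr rfl fun k _ => by split_ifs with hk <;> simp [*]

lemma lam_mono {p p' : K → ℝ} {r : Fin R} (h : ∀ k, rs.cls k = r → p k ≤ p' k) :
    rs.lam p r ≤ rs.lam p' r :=
  Finset.sum_le_sum fun k _ => by split_ifs with hk <;> simp [*]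

lemma lam_mul_left (c : ℝ) (p : K → ℝ) (r : Fin R) :
    rs.lam (fun k => c * p k) r = c * rs.lam p r := by
  simp [lam, Finset.mul_sum]

lemma lam_add (p p' : K → ℝ) (r : Fin R) :
    rs.lam (fun k => p k + p' k) r = rs.lam p r + rs.lam p' r := by
  simp only [lam_eq_sum_filter, Finset.sum_add_distrib]

lemma lam_sum {I : Type*} [Fintype I] (π : K → I → ℝ) (r : Fin R) :
    rs.lam (fun k => ∑ i, π k i) r = ∑ i, rs.lam (fun k => π k i) r := by
  simp only [lam_eq_sum_filter]
  exact Finset.sum_comm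

lemma sum_lam (p : K → ℝ) : ∑ r, rs.lam p r = ∑ k, p k := by
  simp only [lam]
  rw [Finset.sum_comm]
  simp

lemma eq_zero_of_lam_eq_zero {p : K → ℝ} (hp : ∀ k, 0 ≤ p k) {k : K}
    (h : rs.lam p (rs.cls k) = 0) : p k = 0 := by
  rw [lam_eq_sum_filter, Finset.sum_eq_zero_iff_of_nonneg (fun k _ => hp k)] at h
  exact h k (by simp)

lemma lam_pstar (r s : Fin R) : rs.lam (rs.pstar r) s = if r = s then 1 else 0 := by
  split_ifs with h
  · subst h
    rw [← (rs.pstar_mem r).2, lam]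
    refine Finset.sum_congr rfl fun k _ => ?_
    split_ifs with hk
    · rfl
    · by_contra h0
      exact hk (rs.pstar_supp r k (Ne.symm h0))
  · refine Finset.sum_eq_zero fun k _ => ?_
    split_ifs with hk
    · by_contra h0
      exact h ((rs.pstar_supp r k h0).symm.trans hk)
    · rfl

lemma vecMulF_Bmat (p : K → ℝ) (k' : K) :
    vecMulF p rs.Bmat k' = ∑ r, rs.lam p r * rs.pstar r k' := by
  simp only [lam, vecMulF, Bmat, Finset.sum_mul]
  rw [Finset.sum_comm]
  simp

lemma lam_vecMulF_Bmat (p : K → ℝ) (s : Fin R) :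
    rs.lam (vecMulF p rs.Bmat) s = rs.lam p s := by
  have h : vecMulF p rs.Bmat = fun k' => ∑ r, rs.lam p r * rs.pstar r k' :=
    funext (rs.vecMulF_Bmat p)
  rw [h, lam_sum]
  simp [lam_mul_left, lam_pstar]

lemma vecMulF_Bmat_eq_smul_iff (v p : K → ℝ) (c : ℝ) :
    vecMulF v rs.Bmat = c • vecMulF p rs.Bmat ↔ ∀ r, rs.lam v r = c * rs.lam p r := by
  constructor
  · intro h r
    rw [← lam_vecMulF_Bmat, h, ← rs.lam_vecMulF_Bmat p, ← lam_mul_left]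
    rfl
  · intro h
    ext k'
    simp [vecMulF_Bmat, h, Finset.mul_sum, mul_assoc]

lemma cond_nonneg {p : K → ℝ} (hp : ∀ k, 0 ≤ p k) (r : Fin R) (k : K) : 0 ≤ rs.cond p r k := by
  unfold cond
  split_ifs with h
  · dsimp only
    split_ifs
    · exact div_nonneg (hp k) h.le
    · exact le_rfl
  · exact (rs.pstar_mem r).1 k

lemma cond_eq_zero (p : K → ℝ) {r : Fin R} {k : K} (hk : rs.cls k ≠ r) : rs.cond p r k = 0 := by
  unfold cond
  split_ifs with h
  · simp [hk]
  · by_contra h0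
    exact hk (rs.pstar_supp r k h0)

lemma lam_mul_cond {p : K → ℝ} (hp : ∀ k, 0 ≤ p k) (k : K) :
    rs.lam p (rs.cls k) * rs.cond p (rs.cls k) k = p k := by
  rcases (rs.lam_nonneg hp (rs.cls k)).eq_or_lt' with h | h
  · rw [h, rs.eq_zero_of_lam_eq_zero hp h, zero_mul]
  · simp only [cond, if_pos h, if_true]
    field_simp

lemma lam_cond (p : K → ℝ) (r : Fin R) : rs.lam (rs.cond p r) r = 1 := by
  by_cases h : 0 < rs.lam p r
  · rw [rs.lam_congr (p' := fun k => (rs.lam p r)⁻¹ * p k), lam_mul_left, inv_mul_cancel₀ h.ne']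
    intro k hk
    simp [cond, h, hk, div_eq_inv_mul]
  · simp [cond, h, lam_pstar]

lemma dist1_cond (p p' : K → ℝ) (r : Fin R) :
    dist1 (rs.cond p r) (rs.cond p' r) = rs.lam (fun k => |rs.cond p r k - rs.cond p' r k|) r := by
  refine Finset.sum_congr rfl fun k _ => ?_
  split_ifs with h
  · rfl
  · simp [rs.cond_eq_zero _ h]

namespace IsCompatible

variable {rs} {M : K → K → ℝ} (hM : rs.IsCompatible M)
include hM

lemma vecMulF_mem {p : K → ℝ} (hp : p ∈ stdSimplex ℝ K) : vecMulF p M ∈ stdSimplex ℝ K := by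
  refine ⟨fun k => Finset.sum_nonneg fun k' _ => mul_nonneg (hp.1 _) (hM.nonneg _ _), ?_⟩
  simp only [vecMulF]
  rw [Finset.sum_comm]
  simp [← Finset.mul_sum, hM.rowSum, hp.2]

lemma lam_row (k : K) (r : Fin R) : rs.lam (M k) r = if rs.cls k = r then 1 else 0 := by
  split_ifs with h
  · rw [← hM.rowSum k]
    refine Finset.sum_congr rfl fun k' _ => ?_
    split_ifs with hk
    · rfl
    · exact (hM.block k k' fun h' => hk (h' ▸ h)).symm
  · refine Finset.sum_eq_zero fun k' _ => ?_
    split_ifs with hk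
    · exact hM.block k k' fun h' => h (h'.trans hk)
    · rfl

lemma lam_vecMulF (p : K → ℝ) (r : Fin R) : rs.lam (vecMulF p M) r = rs.lam p r := by
  unfold vecMulF
  rw [lam_sum]
  simp only [lam_mul_left, hM.lam_row]
  simp [lam]

lemma lam_abs_vecMulF_le (v : K → ℝ) (r : Fin R) :
    rs.lam (fun k => |vecMulF v M k|) r ≤ rs.lam (fun k => |v k|) r := by
  calc rs.lam (fun k => |vecMulF v M k|) r
      ≤ rs.lam (vecMulF (fun k => |v k|) M) r := by
        refine rs.lam_mono fun k _ => (Finset.abs_sum_le_sum_abs _ _).trans (le_of_eq ?_)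
        refine Finset.sum_congr rfl fun k' _ => ?_
        rw [abs_mul, abs_of_nonneg (hM.nonneg _ _)]
    _ = _ := hM.lam_vecMulF _ r

lemma vecMulF_congr_class {v w : K → ℝ} {k : K}
    (h : ∀ k', rs.cls k' = rs.cls k → v k' = w k') : vecMulF v M k = vecMulF w M k := by
  refine Finset.sum_congr rfl fun k' _ => ?_
  by_cases hk : rs.cls k' = rs.cls k
  · rw [h k' hk]
  · rw [hM.block k' k hk, mul_zero, mul_zero]

end IsCompatible

end RecStruct

/-- If two probability vectors on `s` are close, every family of lotteries for the first one can
be transported to the second with the same marginal on actions and a close joint law. -/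
lemma exists_transport {K I : Type*} [Fintype I] (s : Finset K) {P P' : K → ℝ} (hP : ∀ k, 0 ≤ P k)
    (hsum : ∑ k ∈ s, P k = ∑ k ∈ s, P' k) {x : K → I → ℝ} (hx : ∀ k, x k ∈ stdSimplex ℝ I) :
    ∃ x' : K → I → ℝ, (∀ k, x' k ∈ stdSimplex ℝ I) ∧
      (∀ i, ∑ k ∈ s, P' k * x' k i = ∑ k ∈ s, P k * x k i) ∧
      ∑ k ∈ s, ∑ i, |P k * x k i - P' k * x' k i| ≤ ∑ k ∈ s, |P k - P' k| := by
  set d := ∑ k ∈ s, max (P k - P' k) 0 with hd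
  have hd' : ∑ k ∈ s, max (P' k - P k) 0 = d := by
    have : ∑ k ∈ s, max (P' k - P k) 0 = d - ∑ k ∈ s, P k + ∑ k ∈ s, P' k := by
      rw [hd, ← Finset.sum_sub_distrib, ← Finset.sum_add_distrib]
      refine Finset.sum_congr rfl fun k _ => ?_
      rcases le_total (P k) (P' k) with h | h
      · rw [max_eq_left (by linarith), max_eq_right (by linarith)]; ring
      · rw [max_eq_right (by linarith), max_eq_left (by linarith)]; ring
    linarith
  have hd0 : 0 ≤ d := Finset.sum_nonneg fun k _ => le_max_right _ _
  rcases hd0.eq_or_lt' with h0 | hpos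
  · have heq : ∀ k ∈ s, P k = P' k := by
      intro k hk
      have h1 := (Finset.sum_eq_zero_iff_of_nonneg
        (fun k _ => le_max_right (P k - P' k) 0)).1 (hd.symm.trans h0) k hk
      have h2 := (Finset.sum_eq_zero_iff_of_nonneg
        (fun k _ => le_max_right (P' k - P k) 0)).1 (hd'.trans h0) k hk
      have h3 := max_eq_right_iff.1 h1
      have h4 := max_eq_right_iff.1 h2
      linarith
    refine ⟨x, hx, fun i => Finset.sum_congr rfl fun k hk => by rw [heq k hk], ?_⟩
    refine Finset.sum_le_sum fun k hk => ?_
    simp [heq k hk]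
  · set z : I → ℝ := fun i => (∑ k ∈ s, max (P k - P' k) 0 * x k i) / d with hz
    have hzi : ∀ i, d * z i = ∑ k ∈ s, max (P k - P' k) 0 * x k i := fun i => by
      rw [hz]; field_simp
    have hzmem : z ∈ stdSimplex ℝ I := by
      refine ⟨fun i => div_nonneg (Finset.sum_nonneg fun k _ =>
        mul_nonneg (le_max_right _ _) ((hx k).1 i)) hd0, ?_⟩
      simp only [hz]
      rw [← Finset.sum_div, Finset.sum_comm]
      simp only [← Finset.mul_sum, fun k => (hx k).2, mul_one]
      exact div_self hpos.ne'
    set x' : K → I → ℝ := fun k =>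
      if P' k ≤ P k then x k
      else fun i => (P k * x k i + (P' k - P k) * z i) / P' k with hx'
    have key : ∀ k i, P k * x k i - P' k * x' k i
        = max (P k - P' k) 0 * x k i - max (P' k - P k) 0 * z i := by
      intro k i
      by_cases h : P' k ≤ P k
      · rw [max_eq_left (by linarith), max_eq_right (by linarith)]
        simp only [hx', if_pos h]; ring
      · have h' := not_le.1 h
        have : P' k ≠ 0 := ((hP k).trans_lt h').ne'
        rw [max_eq_right (by linarith), max_eq_left (by linarith)]
        simp only [hx', if_neg h]; field_simp; ring
    refine ⟨x', fun k => ?_, fun i => ?_, ?_⟩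
    · by_cases h : P' k ≤ P k
      · simp only [hx', if_pos h]; exact hx k
      · have h' := not_le.1 h
        have h0 : 0 < P' k := (hP k).trans_lt h'
        simp only [hx', if_neg h]
        refine ⟨fun i => div_nonneg (add_nonneg (mul_nonneg (hP k) ((hx k).1 i))
          (mul_nonneg (by linarith) (hzmem.1 i))) h0.le, ?_⟩
        rw [← Finset.sum_div, Finset.sum_add_distrib, ← Finset.mul_sum, ← Finset.mul_sum,
          (hx k).2, hzmem.2]
        field_simp; ring
    · have : ∑ k ∈ s, (P k * x k i - P' k * x' k i) = 0 := by
        simp only [key]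
        rw [Finset.sum_sub_distrib, ← Finset.sum_mul, hd', hzi, sub_self]
      rw [Finset.sum_sub_distrib] at this
      linarith
    · refine Finset.sum_le_sum fun k _ => ?_
      calc ∑ i, |P k * x k i - P' k * x' k i|
          ≤ ∑ i, (max (P k - P' k) 0 * x k i + max (P' k - P k) 0 * z i) := by
            refine Finset.sum_le_sum fun i _ => ?_
            rw [key]
            refine (abs_sub _ _).trans (le_of_eq ?_)
            rw [abs_of_nonneg (mul_nonneg (le_max_right _ _) ((hx k).1 i)),
              abs_of_nonneg (mul_nonneg (le_max_right _ _) (hzmem.1 i))]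
        _ = max (P k - P' k) 0 + max (P' k - P k) 0 := by
            rw [Finset.sum_add_distrib, ← Finset.mul_sum, ← Finset.mul_sum, (hx k).2, hzmem.2,
              mul_one, mul_one]
        _ ≤ |P k - P' k| := by
            rcases le_total (P k) (P' k) with h | h
            · rw [max_eq_right (by linarith), max_eq_left (by linarith), abs_of_nonpos
                (by linarith)]; linarith
            · rw [max_eq_left (by linarith), max_eq_right (by linarith), abs_of_nonneg
                (by linarith)]; linarith

section Strategy

variable {K I : Type*} [Fintype K] [Fintype I] {R : ℕ} {rs : RecStruct K R}

lemma xOfp_nonneg {p : K → ℝ} (hp : p ∈ stdSimplex ℝ K) {x : K → I → ℝ}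
    (hx : ∀ k, x k ∈ stdSimplex ℝ I) (i : I) : 0 ≤ xOfp p x i :=
  Finset.sum_nonneg fun k _ => mul_nonneg (hp.1 k) ((hx k).1 i)

lemma sum_xOfp {p : K → ℝ} (hp : p ∈ stdSimplex ℝ K) {x : K → I → ℝ}
    (hx : ∀ k, x k ∈ stdSimplex ℝ I) : ∑ i, xOfp p x i = 1 := by
  simp only [xOfp]
  rw [Finset.sum_comm]
  simp [← Finset.mul_sum, fun k => (hx k).2, hp.2]

lemma pvec_mem {p : K → ℝ} (hp : p ∈ stdSimplex ℝ K) {x : K → I → ℝ}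
    (hx : ∀ k, x k ∈ stdSimplex ℝ I) {i : I} (hi : xOfp p x i ≠ 0) :
    pvec p x i ∈ stdSimplex ℝ K := by
  refine ⟨fun k => div_nonneg (mul_nonneg (hp.1 k) ((hx k).1 i)) (xOfp_nonneg hp hx i), ?_⟩
  simp only [pvec]
  rw [← Finset.sum_div]
  exact div_self hi

lemma mem_NR_iff {p : K → ℝ} {x : K → I → ℝ} :
    x ∈ NR rs p ↔ (∀ k, x k ∈ stdSimplex ℝ I) ∧
      ∀ i r, rs.lam (fun k => p k * x k i) r = xOfp p x i * rs.lam p r := by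
  simp only [NR, Set.mem_ofPred_eq, RecStruct.vecMulF_Bmat_eq_smul_iff]

lemma lam_pvec {p : K → ℝ} {x : K → I → ℝ} (hx : x ∈ NR rs p) {i : I}
    (hi : xOfp p x i ≠ 0) (r : Fin R) : rs.lam (pvec p x i) r = rs.lam p r := by
  have h := (mem_NR_iff.1 hx).2 i r
  have e : pvec p x i = fun k => (xOfp p x i)⁻¹ * (p k * x k i) := by
    ext k
    simp [pvec, div_eq_inv_mul]
  rw [e, RecStruct.lam_mul_left, h, inv_mul_cancel_left₀ hi]

lemma NR_nonempty [Nonempty I] {p : K → ℝ} (hp : p ∈ stdSimplex ℝ K) :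
    (NR rs p : Set (K → I → ℝ)).Nonempty := by
  classical
  obtain ⟨i₀⟩ := ‹Nonempty I›
  refine ⟨fun _ => Pi.single i₀ 1, mem_NR_iff.2 ⟨fun _ => single_mem_stdSimplex ℝ i₀, ?_⟩⟩
  intro i r
  simp only [xOfp, ← Finset.sum_mul, hp.2, one_mul]
  rw [← RecStruct.lam_mul_left]
  simp only [mul_comm]

lemma exists_NR_close {p p' : K → ℝ} (hp : p ∈ stdSimplex ℝ K)
    (hp' : p' ∈ stdSimplex ℝ K) {x : K → I → ℝ} (hx : x ∈ NR rs p) :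
    ∃ x' ∈ NR rs p', (∀ i, xOfp p' x' i = xOfp p x i) ∧
      ∑ k, ∑ i, |p k * x k i - p' k * x' k i| ≤ rs.Sdist p p' ∧
      ∀ r, 0 < rs.lam p r →
        ∑ i, rs.lam (fun k => |rs.cond p r k * x k i - rs.cond p' r k * x' k i|) r
          ≤ dist1 (rs.cond p r) (rs.cond p' r) := by
  obtain ⟨hx1, hx2⟩ := mem_NR_iff.1 hx
  set xt : K → I → ℝ := fun k => if rs.lam p (rs.cls k) = 0 then xOfp p x else x k with hxt
  have hxtmem : ∀ k, xt k ∈ stdSimplex ℝ I := fun k => by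
    simp only [hxt]
    split_ifs
    · exact ⟨xOfp_nonneg hp hx1, sum_xOfp hp hx1⟩
    · exact hx1 k
  choose X hX1 hX2 hX3 using fun r => exists_transport
    (univ.filter fun k => rs.cls k = r) (P' := rs.cond p' r) (rs.cond_nonneg hp.1 r)
    (by rw [← rs.lam_eq_sum_filter, ← rs.lam_eq_sum_filter, rs.lam_cond, rs.lam_cond]) hxtmem
  have hmargt : ∀ r i, rs.lam (fun k => rs.cond p r k * xt k i) r = xOfp p x i := by
    intro r i
    by_cases h : rs.lam p r = 0
    · rw [rs.lam_congr (p' := fun k => xOfp p x i * rs.cond p r k), rs.lam_mul_left, rs.lam_cond,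
        mul_one]
      intro k hk
      simp [hxt, hk, h, mul_comm]
    · have hpos := lt_of_le_of_ne (rs.lam_nonneg hp.1 r) (Ne.symm h)
      rw [rs.lam_congr (p' := fun k => (rs.lam p r)⁻¹ * (p k * x k i)), rs.lam_mul_left, hx2]
      · field_simp
      · intro k hk
        simp only [hxt, hk, h, RecStruct.cond, if_pos hpos, if_true, if_false]
        field_simp
  set x' : K → I → ℝ := fun k => X (rs.cls k) k with hx'
  have hx'mem : ∀ k, x' k ∈ stdSimplex ℝ I := fun k => hX1 _ k
  have hmarg : ∀ r i, rs.lam (fun k => rs.cond p' r k * x' k i) r = xOfp p x i := by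
    intro r i
    rw [rs.lam_congr (p' := fun k => rs.cond p' r k * X r k i), rs.lam_eq_sum_filter, hX2,
      ← rs.lam_eq_sum_filter, hmargt]
    rintro k rfl
    rfl
  have hjoint : ∀ r i, rs.lam (fun k => p' k * x' k i) r = xOfp p x i * rs.lam p' r := by
    intro r i
    rw [rs.lam_congr (p' := fun k => rs.lam p' r * (rs.cond p' r k * x' k i)), rs.lam_mul_left,
      hmarg, mul_comm]
    rintro k rfl
    rw [← mul_assoc, rs.lam_mul_cond hp'.1]
  have hxi : ∀ i, xOfp p' x' i = xOfp p x i := by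
    intro i
    rw [xOfp, ← rs.sum_lam]
    simp only [hjoint]
    rw [← Finset.mul_sum, rs.sum_lam, hp'.2, mul_one]
  have hclose : ∀ r, 0 < rs.lam p r →
      rs.lam (fun k => ∑ i, |rs.cond p r k * x k i - rs.cond p' r k * x' k i|) r
        ≤ dist1 (rs.cond p r) (rs.cond p' r) := by
    intro r hr
    rw [rs.dist1_cond, rs.lam_eq_sum_filter (fun k => |rs.cond p r k - rs.cond p' r k|)]
    refine le_trans (le_of_eq ?_) (hX3 r)
    rw [← rs.lam_eq_sum_filter]
    refine rs.lam_congr ?_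
    rintro k rfl
    simp [hxt, hx', hr.ne']
  refine ⟨x', mem_NR_iff.2 ⟨hx'mem, fun i r => by rw [hjoint, hxi]⟩, hxi, ?_, ?_⟩
  · rw [← rs.sum_lam, RecStruct.Sdist, dist1, ← Finset.sum_add_distrib]
    refine Finset.sum_le_sum fun r _ => ?_
    have hl := rs.lam_nonneg hp.1 r
    have hl' := rs.lam_nonneg hp'.1 r
    rcases hl.eq_or_lt' with h | h
    · rw [h, zero_mul, if_neg (lt_irrefl _), add_zero, zero_sub, abs_neg, abs_of_nonneg hl']
      refine le_of_eq (rs.lam_congr ?_)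
      rintro k rfl
      simp only [rs.eq_zero_of_lam_eq_zero hp.1 h, zero_mul, zero_sub, abs_neg,
        abs_of_nonneg (mul_nonneg (hp'.1 k) ((hx'mem k).1 _))]
      rw [← Finset.mul_sum, (hx'mem k).2, mul_one]
    rcases hl'.eq_or_lt' with h' | h'
    · rw [h', mul_zero, if_neg (lt_irrefl _), add_zero, sub_zero, abs_of_nonneg hl]
      refine le_of_eq (rs.lam_congr ?_)
      rintro k rfl
      simp only [rs.eq_zero_of_lam_eq_zero hp'.1 h', zero_mul, sub_zero,
        abs_of_nonneg (mul_nonneg (hp.1 k) ((hx1 k).1 _))]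
      rw [← Finset.mul_sum, (hx1 k).2, mul_one]
    rw [if_pos (mul_pos h h')]
    calc rs.lam (fun k => ∑ i, |p k * x k i - p' k * x' k i|) r
        ≤ rs.lam (fun k => |rs.lam p r - rs.lam p' r| * rs.cond p r k + rs.lam p' r *
            ∑ i, |rs.cond p r k * x k i - rs.cond p' r k * x' k i|) r := by
          refine rs.lam_mono ?_
          rintro k rfl
          refine le_trans (Finset.sum_le_sum fun i _ => ?_) (le_of_eq
            (?_ : ∑ i, (|rs.lam p (rs.cls k) - rs.lam p' (rs.cls k)| *
              (rs.cond p (rs.cls k) k * x k i) + rs.lam p' (rs.cls k) *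
                |rs.cond p (rs.cls k) k * x k i - rs.cond p' (rs.cls k) k * x' k i|) = _))
          swap
          · rw [Finset.sum_add_distrib, ← Finset.mul_sum, ← Finset.mul_sum, ← Finset.mul_sum,
              (hx1 k).2, mul_one]
          have e : p k * x k i - p' k * x' k i =
              (rs.lam p (rs.cls k) - rs.lam p' (rs.cls k)) * (rs.cond p (rs.cls k) k * x k i) +
              rs.lam p' (rs.cls k) *
                (rs.cond p (rs.cls k) k * x k i - rs.cond p' (rs.cls k) k * x' k i) := by
            linear_combination (-x k i) * rs.lam_mul_cond hp.1 k
              + x' k i * rs.lam_mul_cond hp'.1 k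
          rw [e]
          refine (abs_add_le _ _).trans (le_of_eq ?_)
          rw [abs_mul, abs_mul (rs.lam p' _), abs_of_nonneg hl',
            abs_of_nonneg (mul_nonneg (rs.cond_nonneg hp.1 _ k) ((hx1 k).1 i))]
      _ ≤ _ := by
          rw [rs.lam_add, rs.lam_mul_left, rs.lam_mul_left, rs.lam_cond, mul_one]
          have := mul_le_mul_of_nonneg_left (hclose r h) hl'
          linarith
  · intro r hr
    rw [← rs.lam_sum]
    exact hclose r hr

/-- The payoff of one player against a fixed opponent, with stage payoff `c` and continuation
value `h`. -/
noncomputable def sidePayoff (M : K → K → ℝ) (c : K → I → ℝ) (α : ℝ) (h : (K → ℝ) → ℝ)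
    (p : K → ℝ) (x : K → I → ℝ) : ℝ :=
  α * ∑ k, ∑ i, p k * x k i * c k i +
    (1 - α) * ∑ i, xOfp p x i * h (vecMulF (pvec p x i) M)

/-- The properties of the class `F` in one variable. -/
structure IsSideValue (rs : RecStruct K R) (h : (K → ℝ) → ℝ) : Prop where
  lip : ∀ p ∈ stdSimplex ℝ K, ∀ p' ∈ stdSimplex ℝ K, h p - h p' ≤ rs.Sdist p p'
  concave : ∀ pst ∈ rs.Pset, ∀ p ∈ rs.Binv pst, ∀ p' ∈ rs.Binv pst, ∀ a b : ℝ, 0 ≤ a → 0 ≤ b →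
    a + b = 1 → a * h p + b * h p' ≤ h (a • p + b • p')

lemma vecMulF_mul_left (c : ℝ) (v : K → ℝ) (M : K → K → ℝ) (k : K) :
    vecMulF (fun k => c * v k) M k = c * vecMulF v M k := by
  simp [vecMulF, Finset.mul_sum, mul_assoc]

lemma vecMulF_sub (v w : K → ℝ) (M : K → K → ℝ) (k : K) :
    vecMulF (fun k => v k - w k) M k = vecMulF v M k - vecMulF w M k := by
  simp [vecMulF, sub_mul]

lemma xOfp_mul_cond {M : K → K → ℝ} (hM : rs.IsCompatible M) {p : K → ℝ} {x : K → I → ℝ}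
    (hx : x ∈ NR rs p) {i : I} (hi : xOfp p x i ≠ 0) {r : Fin R} (hr : 0 < rs.lam p r)
    {k : K} (hk : rs.cls k = r) :
    xOfp p x i * rs.cond (vecMulF (pvec p x i) M) r k
      = vecMulF (fun k => rs.cond p r k * x k i) M k := by
  have hl : rs.lam (vecMulF (pvec p x i) M) r = rs.lam p r := by
    rw [hM.lam_vecMulF, lam_pvec hx hi]
  subst hk
  rw [RecStruct.cond, hl, if_pos hr]
  simp only [if_true]
  rw [← mul_div_assoc, mul_div_right_comm, ← vecMulF_mul_left]
  refine hM.vecMulF_congr_class fun k' hk' => ?_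
  simp only [RecStruct.cond, if_pos hr, hk', if_true, pvec]
  field_simp

lemma sum_xOfp_mul_Sdist_le {M : K → K → ℝ} (hM : rs.IsCompatible M) {p p' : K → ℝ}
    (hp : p ∈ stdSimplex ℝ K) (hp' : p' ∈ stdSimplex ℝ K) {x x' : K → I → ℝ}
    (hx : x ∈ NR rs p) (hx' : x' ∈ NR rs p') (hxi : ∀ i, xOfp p' x' i = xOfp p x i)
    (hclose : ∀ r, 0 < rs.lam p r →
        ∑ i, rs.lam (fun k => |rs.cond p r k * x k i - rs.cond p' r k * x' k i|) r
          ≤ dist1 (rs.cond p r) (rs.cond p' r)) :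
    ∑ i, xOfp p x i * rs.Sdist (vecMulF (pvec p x i) M) (vecMulF (pvec p' x' i) M)
      ≤ rs.Sdist p p' := by
  have step : ∀ i, xOfp p x i * rs.Sdist (vecMulF (pvec p x i) M) (vecMulF (pvec p' x' i) M)
      ≤ xOfp p x i * dist1 (rs.lam p) (rs.lam p') + ∑ r, if 0 < rs.lam p r * rs.lam p' r
        then rs.lam p' r *
          rs.lam (fun k => |rs.cond p r k * x k i - rs.cond p' r k * x' k i|) r else 0 := by
    intro i
    by_cases hi : xOfp p x i = 0
    · rw [hi, zero_mul, zero_mul, zero_add]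
      refine Finset.sum_nonneg fun r _ => ?_
      split_ifs
      · exact mul_nonneg (rs.lam_nonneg hp'.1 r) (rs.lam_nonneg (fun k => abs_nonneg _) r)
      · exact le_rfl
    · have hi' : xOfp p' x' i ≠ 0 := by rwa [hxi]
      have hl : rs.lam (vecMulF (pvec p x i) M) = rs.lam p :=
        funext fun r => by rw [hM.lam_vecMulF, lam_pvec hx hi]
      have hl' : rs.lam (vecMulF (pvec p' x' i) M) = rs.lam p' :=
        funext fun r => by rw [hM.lam_vecMulF, lam_pvec hx' hi']
      rw [RecStruct.Sdist, hl, hl', mul_add, Finset.mul_sum]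
      gcongr with r _
      split_ifs with hr
      · have hr1 : 0 < rs.lam p r := (pos_of_mul_pos_left hr (rs.lam_nonneg hp'.1 r))
        have hr2 : 0 < rs.lam p' r := (pos_of_mul_pos_right hr hr1.le)
        rw [mul_left_comm]
        gcongr
        rw [rs.dist1_cond, ← rs.lam_mul_left]
        refine le_trans (le_of_eq (rs.lam_congr fun k hk => ?_)) (hM.lam_abs_vecMulF_le
          (fun k => rs.cond p r k * x k i - rs.cond p' r k * x' k i) r)
        rw [vecMulF_sub, ← xOfp_mul_cond hM hx hi hr1 hk, ← xOfp_mul_cond hM hx' hi' hr2 hk, hxi,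
          ← mul_sub, abs_mul, abs_of_nonneg (xOfp_nonneg hp (mem_NR_iff.1 hx).1 i)]
      · simp
  refine (Finset.sum_le_sum fun i _ => step i).trans ?_
  rw [Finset.sum_add_distrib, ← Finset.sum_mul, sum_xOfp hp (mem_NR_iff.1 hx).1, one_mul,
    Finset.sum_comm, RecStruct.Sdist]
  gcongr with r _
  split_ifs with hr
  · have hr1 : 0 < rs.lam p r := (pos_of_mul_pos_left hr (rs.lam_nonneg hp'.1 r))
    rw [← Finset.mul_sum]
    exact mul_le_mul_of_nonneg_left (hclose r hr1) (rs.lam_nonneg hp'.1 r)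
  · simp

lemma exists_sidePayoff_sub_le {M : K → K → ℝ} (hM : rs.IsCompatible M) {α : ℝ}
    (hα : α ∈ Set.Icc (0 : ℝ) 1) {p p' : K → ℝ}
    (hp : p ∈ stdSimplex ℝ K) (hp' : p' ∈ stdSimplex ℝ K) {x : K → I → ℝ} (hx : x ∈ NR rs p) :
    ∃ x' ∈ NR rs p', ∀ c : K → I → ℝ, (∀ k i, |c k i| ≤ 1) → ∀ h, IsSideValue rs h →
      sidePayoff M c α h p x - sidePayoff M c α h p' x' ≤ rs.Sdist p p' := by
  obtain ⟨x', hx', hxi, hjoint, hclose⟩ := exists_NR_close hp hp' hx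
  refine ⟨x', hx', fun c hc h hh => ?_⟩
  have h1 : ∑ k, ∑ i, p k * x k i * c k i - ∑ k, ∑ i, p' k * x' k i * c k i
      ≤ rs.Sdist p p' := by
    refine le_trans ?_ hjoint
    simp only [← Finset.sum_sub_distrib, ← sub_mul]
    refine Finset.sum_le_sum fun k _ => Finset.sum_le_sum fun i _ => ?_
    refine (le_abs_self _).trans ?_
    rw [abs_mul]
    exact mul_le_of_le_one_right (abs_nonneg _) (hc k i)
  have h2 : ∑ i, xOfp p x i * h (vecMulF (pvec p x i) M)
      - ∑ i, xOfp p' x' i * h (vecMulF (pvec p' x' i) M) ≤ rs.Sdist p p' := by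
    refine le_trans ?_ (sum_xOfp_mul_Sdist_le hM hp hp' hx hx' hxi hclose)
    simp only [hxi, ← Finset.sum_sub_distrib, ← mul_sub]
    refine Finset.sum_le_sum fun i _ => ?_
    by_cases hi : xOfp p x i = 0
    · simp [hi]
    · refine mul_le_mul_of_nonneg_left ?_ (xOfp_nonneg hp (mem_NR_iff.1 hx).1 i)
      exact hh.lip _ (hM.vecMulF_mem (pvec_mem hp (mem_NR_iff.1 hx).1 hi)) _
        (hM.vecMulF_mem (pvec_mem hp' (mem_NR_iff.1 hx').1 (by rwa [hxi])))
  have h3 := mul_le_mul_of_nonneg_left h1 hα.1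
  have h4 := mul_le_mul_of_nonneg_left h2 (sub_nonneg.2 hα.2)
  unfold sidePayoff
  linarith

lemma convex_Binv (pst : K → ℝ) : Convex ℝ (rs.Binv pst) := by
  intro p hp p' hp' a b ha hb hab
  refine ⟨convex_stdSimplex ℝ K hp.1 hp'.1 ha hb hab, ?_⟩
  have e : vecMulF (a • p + b • p') rs.Bmat
      = a • vecMulF p rs.Bmat + b • vecMulF p' rs.Bmat := by
    ext k
    simp [vecMulF, add_mul, Finset.sum_add_distrib, Finset.mul_sum, mul_assoc]
  rw [e, hp.2, hp'.2, ← add_smul, hab, one_smul]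

lemma lam_eq_of_mem_Binv {pst p p' : K → ℝ} (hp : p ∈ rs.Binv pst) (hp' : p' ∈ rs.Binv pst)
    (r : Fin R) : rs.lam p r = rs.lam p' r := by
  rw [← rs.lam_vecMulF_Bmat, hp.2, ← hp'.2, rs.lam_vecMulF_Bmat]

/-- The homogeneous extension of `v ↦ h (vM)` to nonnegative vectors. -/
noncomputable def homExt (M : K → K → ℝ) (h : (K → ℝ) → ℝ) (v : K → ℝ) : ℝ :=
  (∑ k, v k) * h (vecMulF (fun k => v k / ∑ k, v k) M)

lemma homExt_mul_left (M : K → K → ℝ) (h : (K → ℝ) → ℝ) (c : ℝ) (v : K → ℝ) :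
    homExt M h (fun k => c * v k) = c * homExt M h v := by
  by_cases hc : c = 0
  · simp [homExt, hc]
  · simp only [homExt, ← Finset.mul_sum, mul_div_mul_left _ _ hc, mul_assoc]

lemma normalize_mem_Binv {M : K → K → ℝ} (hM : rs.IsCompatible M) {pst p v : K → ℝ}
    (hp : p ∈ rs.Binv pst) (hv : ∀ k, 0 ≤ v k) (hpos : 0 < ∑ k, v k)
    (hl : ∀ r, rs.lam v r = (∑ k, v k) * rs.lam p r) :
    vecMulF (fun k => v k / ∑ k, v k) M ∈ rs.Binv pst := by
  refine ⟨hM.vecMulF_mem ⟨fun k => div_nonneg (hv k) hpos.le, ?_⟩, ?_⟩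
  · rw [← Finset.sum_div, div_self hpos.ne']
  · rw [← hp.2, ← one_smul ℝ (vecMulF p rs.Bmat), rs.vecMulF_Bmat_eq_smul_iff]
    intro r
    rw [hM.lam_vecMulF]
    simp only [div_eq_inv_mul]
    rw [rs.lam_mul_left, hl, inv_mul_cancel_left₀ hpos.ne', one_mul]

lemma homExt_add_le {M : K → K → ℝ} (hM : rs.IsCompatible M) {h : (K → ℝ) → ℝ}
    (hh : IsSideValue rs h) {pst p v w : K → ℝ} (hpst : pst ∈ rs.Pset)
    (hp : p ∈ rs.Binv pst) (hv : ∀ k, 0 ≤ v k) (hw : ∀ k, 0 ≤ w k)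
    (hlv : ∀ r, rs.lam v r = (∑ k, v k) * rs.lam p r)
    (hlw : ∀ r, rs.lam w r = (∑ k, w k) * rs.lam p r) :
    homExt M h v + homExt M h w ≤ homExt M h (fun k => v k + w k) := by
  rcases (Finset.sum_nonneg fun k (_ : k ∈ univ) => hv k).eq_or_lt' with h0 | h0
  · have hz : ∀ k, v k = 0 := fun k =>
      (Finset.sum_eq_zero_iff_of_nonneg fun k _ => hv k).1 h0 k (mem_univ k)
    simp [homExt, hz]
  rcases (Finset.sum_nonneg fun k (_ : k ∈ univ) => hw k).eq_or_lt' with h1 | h1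
  · have hz : ∀ k, w k = 0 := fun k =>
      (Finset.sum_eq_zero_iff_of_nonneg fun k _ => hw k).1 h1 k (mem_univ k)
    simp [homExt, hz]
  have key := hh.concave pst hpst _ (normalize_mem_Binv hM hp hv h0 hlv) _
    (normalize_mem_Binv hM hp hw h1 hlw) ((∑ k, v k) / (∑ k, v k + ∑ k, w k))
    ((∑ k, w k) / (∑ k, v k + ∑ k, w k)) (by positivity) (by positivity) (by field_simp)
  have e : ((∑ k, v k) / (∑ k, v k + ∑ k, w k)) • vecMulF (fun k => v k / ∑ k, v k) M
      + ((∑ k, w k) / (∑ k, v k + ∑ k, w k)) • vecMulF (fun k => w k / ∑ k, w k) M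
      = vecMulF (fun k => (v k + w k) / (∑ k, v k + ∑ k, w k)) M := by
    ext k'
    simp only [Pi.add_apply, Pi.smul_apply, smul_eq_mul, vecMulF, Finset.mul_sum,
      ← Finset.sum_add_distrib]
    refine Finset.sum_congr rfl fun k _ => ?_
    rw [Finset.sum_add_distrib]
    field_simp
  rw [e] at key
  unfold homExt
  rw [Finset.sum_add_distrib]
  refine le_trans (le_of_eq ?_) (mul_le_mul_of_nonneg_left key (add_pos h0 h1).le)
  field_simp

lemma exists_sidePayoff_ge {M : K → K → ℝ} (hM : rs.IsCompatible M) {α : ℝ}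
    (hα : α ∈ Set.Icc (0 : ℝ) 1) {pst p₁ p₂ : K → ℝ} (hpst : pst ∈ rs.Pset)
    (hp₁ : p₁ ∈ rs.Binv pst) (hp₂ : p₂ ∈ rs.Binv pst) {a b : ℝ} (ha : 0 ≤ a) (hb : 0 ≤ b)
    (hab : a + b = 1) {x₁ x₂ : K → I → ℝ} (hx₁ : x₁ ∈ NR rs p₁) (hx₂ : x₂ ∈ NR rs p₂) :
    ∃ x ∈ NR rs (a • p₁ + b • p₂), ∀ c : K → I → ℝ, ∀ h, IsSideValue rs h →
      a * sidePayoff M c α h p₁ x₁ + b * sidePayoff M c α h p₂ x₂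
        ≤ sidePayoff M c α h (a • p₁ + b • p₂) x := by
  obtain ⟨hx₁m, hx₁l⟩ := mem_NR_iff.1 hx₁
  obtain ⟨hx₂m, hx₂l⟩ := mem_NR_iff.1 hx₂
  have hp := convex_Binv pst hp₁ hp₂ ha hb hab
  set p := a • p₁ + b • p₂ with hpdef
  have hpk : ∀ k, p k = a * p₁ k + b * p₂ k := fun k => rfl
  have h₁ : ∀ k, 0 ≤ a * p₁ k := fun k => mul_nonneg ha (hp₁.1.1 k)
  have h₂ : ∀ k, 0 ≤ b * p₂ k := fun k => mul_nonneg hb (hp₂.1.1 k)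
  set x : K → I → ℝ := fun k => if p k = 0 then x₁ k else
    fun i => (a * (p₁ k * x₁ k i) + b * (p₂ k * x₂ k i)) / p k with hxdef
  have hjoint : ∀ k i, p k * x k i = a * (p₁ k * x₁ k i) + b * (p₂ k * x₂ k i) := by
    intro k i
    by_cases h0 : p k = 0
    · have e₁ : a * p₁ k = 0 := by linarith [h₁ k, h₂ k, hpk k]
      have e₂ : b * p₂ k = 0 := by linarith [h₁ k, h₂ k, hpk k]
      rw [h0, ← mul_assoc, ← mul_assoc, e₁, e₂]
      ring
    · simp only [hxdef, if_neg h0]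
      field_simp
  have hxm : ∀ k, x k ∈ stdSimplex ℝ I := by
    intro k
    by_cases h0 : p k = 0
    · simp only [hxdef, if_pos h0]
      exact hx₁m k
    · simp only [hxdef, if_neg h0]
      refine ⟨fun i => div_nonneg ?_ (hp.1.1 k), ?_⟩
      · rw [← mul_assoc, ← mul_assoc]
        exact add_nonneg (mul_nonneg (h₁ k) ((hx₁m k).1 i)) (mul_nonneg (h₂ k) ((hx₂m k).1 i))
      · rw [← Finset.sum_div, Finset.sum_add_distrib]
        simp only [← Finset.mul_sum, (hx₁m k).2, (hx₂m k).2, mul_one]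
        rw [← hpk, div_self h0]
  have hxi : ∀ i, xOfp p x i = a * xOfp p₁ x₁ i + b * xOfp p₂ x₂ i := by
    intro i
    simp only [xOfp, hjoint, Finset.sum_add_distrib, Finset.mul_sum]
  refine ⟨x, mem_NR_iff.2 ⟨hxm, fun i r => ?_⟩, fun c h hh => ?_⟩
  · simp only [hjoint]
    rw [rs.lam_add, rs.lam_mul_left, rs.lam_mul_left, hx₁l, hx₂l, hxi,
      lam_eq_of_mem_Binv hp₁ hp, lam_eq_of_mem_Binv hp₂ hp]
    ring
  · have g1 : ∑ k, ∑ i, p k * x k i * c k i = a * ∑ k, ∑ i, p₁ k * x₁ k i * c k i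
        + b * ∑ k, ∑ i, p₂ k * x₂ k i * c k i := by
      simp only [hjoint, Finset.mul_sum, ← Finset.sum_add_distrib]
      refine Finset.sum_congr rfl fun k _ => Finset.sum_congr rfl fun i _ => ?_
      ring
    have g2 : a * ∑ i, xOfp p₁ x₁ i * h (vecMulF (pvec p₁ x₁ i) M)
        + b * ∑ i, xOfp p₂ x₂ i * h (vecMulF (pvec p₂ x₂ i) M)
        ≤ ∑ i, xOfp p x i * h (vecMulF (pvec p x i) M) := by
      rw [Finset.mul_sum, Finset.mul_sum, ← Finset.sum_add_distrib]
      refine Finset.sum_le_sum fun i _ => ?_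
      change a * homExt M h (fun k => p₁ k * x₁ k i) + b * homExt M h (fun k => p₂ k * x₂ k i)
        ≤ homExt M h (fun k => p k * x k i)
      simp only [hjoint]
      rw [← homExt_mul_left, ← homExt_mul_left]
      refine homExt_add_le hM hh hpst hp ?_ ?_ ?_ ?_
      · exact fun k => mul_nonneg ha (mul_nonneg (hp₁.1.1 k) ((hx₁m k).1 i))
      · exact fun k => mul_nonneg hb (mul_nonneg (hp₂.1.1 k) ((hx₂m k).1 i))
      · intro r
        rw [rs.lam_mul_left, hx₁l, lam_eq_of_mem_Binv hp₁ hp, ← Finset.mul_sum, mul_assoc]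
        rfl
      · intro r
        rw [rs.lam_mul_left, hx₂l, lam_eq_of_mem_Binv hp₂ hp, ← Finset.mul_sum, mul_assoc]
        rfl
    have g3 := mul_le_mul_of_nonneg_left g2 (sub_nonneg.2 hα.2)
    unfold sidePayoff
    rw [g1]
    linarith

end Strategy

/-- The stage payoff of player 1 against a fixed strategy of player 2. -/
noncomputable def sideStage {K L I J : Type*} [Fintype L] [Fintype J]
    (g : K → L → I → J → ℝ) (q : L → ℝ) (y : L → J → ℝ) : K → I → ℝ :=
  fun k i => ∑ l, ∑ j, q l * y l j * g k l i j

lemma abs_sideStage_le {K L I J : Type*} [Fintype L] [Fintype J]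
    {g : K → L → I → J → ℝ} (hg : ∀ k l i j, g k l i j ∈ Set.Icc (-1 : ℝ) 1)
    {q : L → ℝ} (hq : q ∈ stdSimplex ℝ L) {y : L → J → ℝ} (hy : ∀ l, y l ∈ stdSimplex ℝ J) (k : K) (i : I) :
    |sideStage g q y k i| ≤ 1 := by
  have hs : ∑ l, ∑ j, q l * y l j = 1 := by
    simp [← Finset.mul_sum, fun l => (hy l).2, hq.2]
  rw [← hs]
  refine (Finset.abs_sum_le_sum_abs _ _).trans (Finset.sum_le_sum fun l _ =>
    (Finset.abs_sum_le_sum_abs _ _).trans (Finset.sum_le_sum fun j _ => ?_))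
  have h0 := mul_nonneg (hq.1 l) ((hy l).1 j)
  rw [abs_mul, abs_of_nonneg h0]
  exact mul_le_of_le_one_right h0 (abs_le.2 (hg k l i j))

section Game

variable {K L I J : Type*} [Fintype K] [Fintype L] [Fintype I] [Fintype J] {RK RL : ℕ}
  {rsK : RecStruct K RK} {rsL : RecStruct L RL} {M : K → K → ℝ} {N : L → L → ℝ}
  {g : K → L → I → J → ℝ} {α : ℝ} {f : (K → ℝ) → (L → ℝ) → ℝ}

/-- The continuation value of player 1 against a fixed strategy of player 2. -/
noncomputable def sideValue (N : L → L → ℝ) (f : (K → ℝ) → (L → ℝ) → ℝ) (q : L → ℝ)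
    (y : L → J → ℝ) : (K → ℝ) → ℝ :=
  fun p => ∑ j, xOfp q y j * f p (vecMulF (pvec q y j) N)

lemma payoff_eq_sidePayoff (p : K → ℝ) (q : L → ℝ) (x : K → I → ℝ) (y : L → J → ℝ) :
    payoff M N g α f p q x y =
      sidePayoff M (sideStage g q y) α (sideValue N f q y) p x := by
  have h1 : Gpay g p q x y = ∑ k, ∑ i, p k * x k i * sideStage g q y k i := by
    simp only [Gpay, sideStage, Finset.mul_sum]
    refine Finset.sum_congr rfl fun k _ => ?_
    rw [Finset.sum_comm]
    refine Finset.sum_congr rfl fun i _ => Finset.sum_congr rfl fun l _ =>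
      Finset.sum_congr rfl fun j _ => ?_
    ring
  simp only [payoff, sidePayoff, sideValue, h1, Finset.mul_sum, mul_assoc]

lemma payoff_swap (p : K → ℝ) (q : L → ℝ) (x : K → I → ℝ) (y : L → J → ℝ) :
    payoff N M (fun l k j i => -g k l i j) α (fun q p => -f p q) q p y x =
      -payoff M N g α f p q x y := by
  have h1 : Gpay (fun l k j i => -g k l i j) q p y x = -Gpay g p q x y := by
    simp only [Gpay, ← Finset.sum_neg_distrib]
    rw [Finset.sum_comm]
    refine Finset.sum_congr rfl fun k _ => Finset.sum_congr rfl fun l _ => ?_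
    rw [Finset.sum_comm]
    refine Finset.sum_congr rfl fun i _ => Finset.sum_congr rfl fun j _ => ?_
    ring
  have h2 : ∑ j, ∑ i, xOfp q y j * xOfp p x i *
      -f (vecMulF (pvec p x i) M) (vecMulF (pvec q y j) N) =
      -∑ i, ∑ j, xOfp p x i * xOfp q y j *
        f (vecMulF (pvec p x i) M) (vecMulF (pvec q y j) N) := by
    simp only [← Finset.sum_neg_distrib]
    rw [Finset.sum_comm]
    refine Finset.sum_congr rfl fun i _ => Finset.sum_congr rfl fun j _ => ?_
    ring
  simp only [payoff, h1, h2]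
  ring

lemma MemF.isSideValue (hf : MemF rsK rsL f) (hN : rsL.IsCompatible N) {q : L → ℝ}
    (hq : q ∈ stdSimplex ℝ L) {y : L → J → ℝ} (hy : ∀ l, y l ∈ stdSimplex ℝ J) :
    IsSideValue rsK (sideValue N f q y) := by
  refine ⟨fun p hp p' hp' => ?_, fun pst hpst p hp p' hp' a b ha hb hab => ?_⟩
  · rw [sideValue, sideValue, ← Finset.sum_sub_distrib, ← one_mul (rsK.Sdist p p'),
      ← sum_xOfp hq hy, Finset.sum_mul]
    refine Finset.sum_le_sum fun j _ => ?_
    rw [← mul_sub]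
    by_cases hj : xOfp q y j = 0
    · simp [hj]
    · exact mul_le_mul_of_nonneg_left
        (hf.lipK p hp p' hp' _ (hN.vecMulF_mem (pvec_mem hq hy hj))) (xOfp_nonneg hq hy j)
  · rw [sideValue, sideValue, sideValue, Finset.mul_sum, Finset.mul_sum, ← Finset.sum_add_distrib]
    refine Finset.sum_le_sum fun j _ => ?_
    rw [mul_left_comm, mul_left_comm b, ← mul_add]
    by_cases hj : xOfp q y j = 0
    · simp [hj]
    · exact mul_le_mul_of_nonneg_left
        ((hf.concaveI pst hpst _ (hN.vecMulF_mem (pvec_mem hq hy hj))).2 hp hp' ha hb hab)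
        (xOfp_nonneg hq hy j)

lemma MemF.swap (hf : MemF rsK rsL f) : MemF rsL rsK (fun q p => -f p q) where
  mem_Icc q hq p hp := by
    have := hf.mem_Icc p hp q hq
    exact ⟨neg_le_neg this.2, by linarith [this.1]⟩
  lipK q hq q' hq' p hp := by linarith [hf.lipL p hp q' hq' q hq]
  lipL q hq p hp p' hp' := by linarith [hf.lipK p' hp' p hp q hq]
  concaveI qst hqst p hp := (hf.convexII qst hqst p hp).neg
  convexII pst hpst q hq := (hf.concaveI pst hpst q hq).neg

lemma payoff_le_one (hM : rsK.IsCompatible M) (hN : rsL.IsCompatible N)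
    (hg : ∀ k l i j, g k l i j ∈ Set.Icc (-1 : ℝ) 1) (hα : α ∈ Set.Icc (0 : ℝ) 1)
    (hf : MemF rsK rsL f) {p : K → ℝ} (hp : p ∈ stdSimplex ℝ K) {q : L → ℝ}
    (hq : q ∈ stdSimplex ℝ L) {x : K → I → ℝ} (hx : x ∈ NR rsK p) {y : L → J → ℝ}
    (hy : y ∈ NR rsL q) : payoff M N g α f p q x y ≤ 1 := by
  obtain ⟨hx, -⟩ := hx
  obtain ⟨hy, -⟩ := hy
  have h1 : ∑ k, ∑ i, p k * x k i * sideStage g q y k i ≤ 1 := by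
    have hs : ∑ k, ∑ i, p k * x k i = 1 := by
      simp [← Finset.mul_sum, fun k => (hx k).2, hp.2]
    rw [← hs]
    refine Finset.sum_le_sum fun k _ => Finset.sum_le_sum fun i _ => ?_
    exact mul_le_of_le_one_right (mul_nonneg (hp.1 k) ((hx k).1 i))
      ((le_abs_self _).trans (abs_sideStage_le hg hq hy k i))
  have h2 : ∑ i, xOfp p x i * sideValue N f q y (vecMulF (pvec p x i) M) ≤ 1 := by
    rw [← sum_xOfp hp hx]
    refine Finset.sum_le_sum fun i _ => ?_
    by_cases hi : xOfp p x i = 0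
    · simp [hi]
    refine mul_le_of_le_one_right (xOfp_nonneg hp hx i) ?_
    rw [← sum_xOfp hq hy]
    refine Finset.sum_le_sum fun j _ => ?_
    by_cases hj : xOfp q y j = 0
    · simp [hj]
    exact mul_le_of_le_one_right (xOfp_nonneg hq hy j)
      (hf.mem_Icc _ (hM.vecMulF_mem (pvec_mem hp hx hi)) _
        (hN.vecMulF_mem (pvec_mem hq hy hj))).2
  rw [payoff_eq_sidePayoff, sidePayoff]
  have h3 := mul_le_mul_of_nonneg_left h1 hα.1
  have h4 := mul_le_mul_of_nonneg_left h2 (sub_nonneg.2 hα.2)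
  linarith

lemma neg_one_le_payoff (hM : rsK.IsCompatible M) (hN : rsL.IsCompatible N)
    (hg : ∀ k l i j, g k l i j ∈ Set.Icc (-1 : ℝ) 1) (hα : α ∈ Set.Icc (0 : ℝ) 1)
    (hf : MemF rsK rsL f) {p : K → ℝ} (hp : p ∈ stdSimplex ℝ K) {q : L → ℝ}
    (hq : q ∈ stdSimplex ℝ L) {x : K → I → ℝ} (hx : x ∈ NR rsK p) {y : L → J → ℝ}
    (hy : y ∈ NR rsL q) : -1 ≤ payoff M N g α f p q x y := by
  have h := payoff_le_one (g := fun l k j i => -g k l i j) hN hM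
    (fun l k j i => ⟨neg_le_neg (hg k l i j).2, by linarith [(hg k l i j).1]⟩) hα hf.swap
    hq hp hy hx
  rw [payoff_swap] at h
  linarith

/-- The amount guaranteed by the strategy `x` of player 1 in the one-shot game. -/
noncomputable def guarantee (rsL : RecStruct L RL) (M : K → K → ℝ) (N : L → L → ℝ)
    (g : K → L → I → J → ℝ) (α : ℝ) (f : (K → ℝ) → (L → ℝ) → ℝ) (p : K → ℝ) (q : L → ℝ)
    (x : K → I → ℝ) : ℝ :=
  sInf {u : ℝ | ∃ y ∈ (NR rsL q : Set (L → J → ℝ)), u = payoff M N g α f p q x y}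

lemma guarantee_le (hM : rsK.IsCompatible M) (hN : rsL.IsCompatible N)
    (hg : ∀ k l i j, g k l i j ∈ Set.Icc (-1 : ℝ) 1) (hα : α ∈ Set.Icc (0 : ℝ) 1)
    (hf : MemF rsK rsL f) {p : K → ℝ} (hp : p ∈ stdSimplex ℝ K) {q : L → ℝ}
    (hq : q ∈ stdSimplex ℝ L) {x : K → I → ℝ} (hx : x ∈ NR rsK p) {y : L → J → ℝ}
    (hy : y ∈ NR rsL q) : guarantee rsL M N g α f p q x ≤ payoff M N g α f p q x y := by
  refine csInf_le ⟨-1, ?_⟩ ⟨y, hy, rfl⟩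
  rintro _ ⟨y', hy', rfl⟩
  exact neg_one_le_payoff hM hN hg hα hf hp hq hx hy'

lemma le_guarantee [Nonempty J] {p : K → ℝ} {q : L → ℝ} (hq : q ∈ stdSimplex ℝ L)
    {x : K → I → ℝ} {t : ℝ} (h : ∀ y ∈ NR rsL q, t ≤ payoff M N g α f p q x y) :
    t ≤ guarantee rsL M N g α f p q x := by
  obtain ⟨y, hy⟩ := NR_nonempty (I := J) (rs := rsL) hq
  refine le_csInf ⟨_, y, hy, rfl⟩ ?_
  rintro _ ⟨y', hy', rfl⟩
  exact h y' hy'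

lemma exists_payoff_lt [Nonempty J] {p : K → ℝ} {q : L → ℝ} (hq : q ∈ stdSimplex ℝ L)
    (x : K → I → ℝ) {ε : ℝ} (hε : 0 < ε) :
    ∃ y ∈ NR rsL q, payoff M N g α f p q x y < guarantee rsL M N g α f p q x + ε := by
  by_contra! h
  linarith [le_guarantee hq h]

lemma guarantee_le_Phi [Nonempty J] (hM : rsK.IsCompatible M) (hN : rsL.IsCompatible N)
    (hg : ∀ k l i j, g k l i j ∈ Set.Icc (-1 : ℝ) 1) (hα : α ∈ Set.Icc (0 : ℝ) 1)
    (hf : MemF rsK rsL f) {p : K → ℝ} (hp : p ∈ stdSimplex ℝ K) {q : L → ℝ}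
    (hq : q ∈ stdSimplex ℝ L) {x : K → I → ℝ} (hx : x ∈ NR rsK p) :
    guarantee rsL M N g α f p q x ≤ Phi rsK rsL M N g α f p q := by
  refine le_csSup ⟨1, ?_⟩ ⟨x, hx, rfl⟩
  rintro _ ⟨x', hx', rfl⟩
  obtain ⟨y, hy⟩ := NR_nonempty (I := J) (rs := rsL) hq
  exact (guarantee_le hM hN hg hα hf hp hq hx' hy).trans
    (payoff_le_one hM hN hg hα hf hp hq hx' hy)

lemma Phi_le [Nonempty I] {p : K → ℝ} (hp : p ∈ stdSimplex ℝ K) {q : L → ℝ} {t : ℝ}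
    (h : ∀ x ∈ NR rsK p, guarantee rsL M N g α f p q x ≤ t) :
    Phi rsK rsL M N g α f p q ≤ t := by
  obtain ⟨x, hx⟩ := NR_nonempty (I := I) (rs := rsK) hp
  refine csSup_le ⟨_, x, hx, rfl⟩ ?_
  rintro _ ⟨x', hx', rfl⟩
  exact h x' hx'

lemma exists_lt_guarantee [Nonempty I] {p : K → ℝ} (hp : p ∈ stdSimplex ℝ K) (q : L → ℝ)
    {ε : ℝ} (hε : 0 < ε) :
    ∃ x ∈ NR rsK p, Phi rsK rsL M N g α f p q - ε < guarantee rsL M N g α f p q x := by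
  by_contra! h
  linarith [Phi_le (rsK := rsK) hp h]

lemma exists_payoff_sub_le (hM : rsK.IsCompatible M) (hN : rsL.IsCompatible N)
    (hg : ∀ k l i j, g k l i j ∈ Set.Icc (-1 : ℝ) 1) (hα : α ∈ Set.Icc (0 : ℝ) 1)
    (hf : MemF rsK rsL f) {p p' : K → ℝ} (hp : p ∈ stdSimplex ℝ K) (hp' : p' ∈ stdSimplex ℝ K)
    {x : K → I → ℝ} (hx : x ∈ NR rsK p) :
    ∃ x' ∈ NR rsK p', ∀ q ∈ stdSimplex ℝ L, ∀ y ∈ (NR rsL q : Set (L → J → ℝ)),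
      payoff M N g α f p q x y - payoff M N g α f p' q x' y ≤ rsK.Sdist p p' := by
  obtain ⟨x', hx', h⟩ := exists_sidePayoff_sub_le hM hα hp hp' hx
  refine ⟨x', hx', fun q hq y hy => ?_⟩
  rw [payoff_eq_sidePayoff, payoff_eq_sidePayoff]
  exact h _ (abs_sideStage_le hg hq hy.1) _ (hf.isSideValue hN hq hy.1)

lemma exists_payoff_ge (hM : rsK.IsCompatible M) (hN : rsL.IsCompatible N)
    (hα : α ∈ Set.Icc (0 : ℝ) 1)
    (hf : MemF rsK rsL f) {pst p₁ p₂ : K → ℝ} (hpst : pst ∈ rsK.Pset)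
    (hp₁ : p₁ ∈ rsK.Binv pst) (hp₂ : p₂ ∈ rsK.Binv pst) {a b : ℝ} (ha : 0 ≤ a) (hb : 0 ≤ b)
    (hab : a + b = 1) {x₁ x₂ : K → I → ℝ} (hx₁ : x₁ ∈ NR rsK p₁) (hx₂ : x₂ ∈ NR rsK p₂) :
    ∃ x ∈ NR rsK (a • p₁ + b • p₂), ∀ q ∈ stdSimplex ℝ L, ∀ y ∈ (NR rsL q : Set (L → J → ℝ)),
      a * payoff M N g α f p₁ q x₁ y + b * payoff M N g α f p₂ q x₂ y
        ≤ payoff M N g α f (a • p₁ + b • p₂) q x y := by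
  obtain ⟨x, hx, h⟩ := exists_sidePayoff_ge hM hα hpst hp₁ hp₂ ha hb hab hx₁ hx₂
  refine ⟨x, hx, fun q hq y hy => ?_⟩
  simp only [payoff_eq_sidePayoff]
  exact h _ _ (hf.isSideValue hN hq hy.1)

end Game

/-- **Stability of the class `F` (key step in the proof of Proposition
`vhatequicontinu`).** For every `α ∈ [0,1]` and every `f ∈ F`, the function `Φ_α(f)`
again belongs to `F`. -/
theorem Phi_maps_F_to_F {K L I J : Type*}
    [Fintype K] [Nonempty K] [Fintype L] [Nonempty L]
    [Fintype I] [Nonempty I] [Fintype J] [Nonempty J] {RK RL : ℕ}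
    (rsK : RecStruct K RK) (rsL : RecStruct L RL)
    (M : K → K → ℝ) (N : L → L → ℝ)
    (hM : rsK.IsCompatible M) (hN : rsL.IsCompatible N)
    (g : K → L → I → J → ℝ) (hg : ∀ k l i j, g k l i j ∈ Set.Icc (-1 : ℝ) 1)
    (α : ℝ) (hα : α ∈ Set.Icc (0 : ℝ) 1)
    (f : (K → ℝ) → (L → ℝ) → ℝ) (hf : MemF rsK rsL f) :
    MemF rsK rsL (Phi rsK rsL M N g α f) := by

  have hg' : ∀ l k j i, (fun l k j i => -g k l i j) l k j i ∈ Set.Icc (-1 : ℝ) 1 :=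
    fun l k j i => ⟨neg_le_neg (hg k l i j).2, by linarith [(hg k l i j).1]⟩
  refine ⟨fun p hp q hq => ⟨?_, ?_⟩, fun p hp p' hp' q hq => ?_, fun p hp q hq q' hq' => ?_,
    fun pst hpst q hq => ⟨convex_Binv pst, fun p₁ hp₁ p₂ hp₂ a b ha hb hab => ?_⟩,
    fun qst hqst p hp => ⟨convex_Binv qst, fun q₁ hq₁ q₂ hq₂ a b ha hb hab => ?_⟩⟩
  · obtain ⟨x, hx⟩ := NR_nonempty (I := I) (rs := rsK) hp
    exact (le_guarantee hq fun y hy => neg_one_le_payoff hM hN hg hα hf hp hq hx hy).trans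
      (guarantee_le_Phi hM hN hg hα hf hp hq hx)
  · obtain ⟨y, hy⟩ := NR_nonempty (I := J) (rs := rsL) hq
    exact Phi_le hp fun x hx => (guarantee_le hM hN hg hα hf hp hq hx hy).trans
      (payoff_le_one hM hN hg hα hf hp hq hx hy)
  · rw [sub_le_iff_le_add]
    refine Phi_le hp fun x hx => ?_
    obtain ⟨x', hx', h⟩ := exists_payoff_sub_le (J := J) hM hN hg hα hf hp hp' hx
    rw [← sub_le_iff_le_add']
    refine le_trans (le_guarantee hq fun y hy => ?_) (guarantee_le_Phi hM hN hg hα hf hp' hq hx')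
    linarith [h q hq y hy, guarantee_le hM hN hg hα hf hp hq hx hy]
  · rw [sub_le_iff_le_add]
    refine Phi_le hp fun x hx => ?_
    rw [← sub_le_iff_le_add']
    refine le_trans (le_guarantee hq' fun y' hy' => ?_) (guarantee_le_Phi hM hN hg hα hf hp hq' hx)
    obtain ⟨y, hy, h⟩ := exists_payoff_sub_le (J := I) hN hM hg' hα hf.swap hq' hq hy'
    have := h p hp x hx
    rw [payoff_swap, payoff_swap] at this
    linarith [guarantee_le hM hN hg hα hf hp hq hx hy]
  · simp only [smul_eq_mul]
    refine le_of_forall_pos_le_add fun ε hε => ?_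
    obtain ⟨x₁, hx₁, h₁⟩ := exists_lt_guarantee (rsK := rsK) (rsL := rsL) (M := M) (N := N)
      (g := g) (α := α) (f := f) hp₁.1 q hε
    obtain ⟨x₂, hx₂, h₂⟩ := exists_lt_guarantee (rsK := rsK) (rsL := rsL) (M := M) (N := N)
      (g := g) (α := α) (f := f) hp₂.1 q hε
    obtain ⟨x, hx, h⟩ := exists_payoff_ge (J := J) (g := g) hM hN hα hf hpst hp₁ hp₂ ha hb hab
      hx₁ hx₂
    rw [← sub_le_iff_le_add]
    refine le_trans (le_guarantee hq fun y hy => le_trans ?_ (h q hq y hy))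
      (guarantee_le_Phi hM hN hg hα hf (convex_Binv pst hp₁ hp₂ ha hb hab).1 hq hx)
    have e₁ := mul_le_mul_of_nonneg_left
      (h₁.le.trans (guarantee_le hM hN hg hα hf hp₁.1 hq hx₁ hy)) ha
    have e₂ := mul_le_mul_of_nonneg_left
      (h₂.le.trans (guarantee_le hM hN hg hα hf hp₂.1 hq hx₂ hy)) hb
    have e₃ : a * ε + b * ε = ε := by rw [← add_mul, hab, one_mul]
    linarith
  · simp only [smul_eq_mul]
    refine Phi_le hp fun x hx => le_of_forall_pos_le_add fun ε hε => ?_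
    obtain ⟨y₁, hy₁, h₁⟩ := exists_payoff_lt (rsL := rsL) (M := M) (N := N)
      (g := g) (α := α) (f := f) (p := p) hq₁.1 x hε
    obtain ⟨y₂, hy₂, h₂⟩ := exists_payoff_lt (rsL := rsL) (M := M) (N := N)
      (g := g) (α := α) (f := f) (p := p) hq₂.1 x hε
    obtain ⟨y, hy, h⟩ := exists_payoff_ge (J := I) (g := fun l k j i => -g k l i j) hN hM hα
      hf.swap hqst hq₁ hq₂ ha hb hab hy₁ hy₂
    have h := h p hp x hx
    simp only [payoff_swap] at h
    have e₀ := guarantee_le hM hN hg hα hf hp (convex_Binv qst hq₁ hq₂ ha hb hab).1 hx hy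
    have e₁ := mul_le_mul_of_nonneg_left (h₁.le.trans
      (add_le_add_left (guarantee_le_Phi hM hN hg hα hf hp hq₁.1 hx) ε)) ha
    have e₂ := mul_le_mul_of_nonneg_left (h₂.le.trans
      (add_le_add_left (guarantee_le_Phi hM hN hg hα hf hp hq₂.1 hx) ε)) hb
    have e₃ : a * ε + b * ε = ε := by rw [← add_mul, hab, one_mul]
    linarith
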